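/- Let χ_1, …, χ_n ∈ ℝ, let U = D(χ_1) ⊗ ⋯ ⊗ D(χ_n) with D(χ)|1⟩ = e^{−iχ/2}|1⟩, D(χ)|0⟩ = e^{iχ/2}|0⟩, and let S̃_±^(n) be the phase-dressed protocol states defined by the recursion S̃_±^(1) = e^{−iχ_1/2}|1⟩ ± e^{iχ_1/2}|0⟩ and S̃_±^(k+1) = e^{−iχ_{k+1}/2} S̃_+^(k) ⊗ |1⟩ ± e^{iχ_{k+1}/2} S̃_-^(k) ⊗ |0⟩. Then for n ≥ 2 and 1 ≤ a ≤ n, the phase-dressed states are eigenvectors of the conjugated stabilizers K̃_n^(a) := U K_n^(a) U⁻¹ with the same eigenvalues as in the unphased case: K̃_n^(a) S̃_+^(n) = (−1)^{k_+^(a)} S̃_+^(n) and K̃_n^(a) S̃_-^(n) = (−1)^{k_-^(a)} S̃_-^(n), where k_+^(a) = 1 iff a ∈ {1, n} and k_-^(a) = 1 iff a = 1 (and both are 0 otherwise). -/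

import Mathlib

/-- The `n`-qubit state space `H_n = (Fin n → Bool) → ℂ`. -/
abbrev H (n : ℕ) := (Fin n → Bool) → ℂ

/-- Computational basis vector `|f⟩`. -/
noncomputable def ket {n : ℕ} (f : Fin n → Bool) : H n := fun g => if g = f then 1 else 0

/-- Single-qubit basis vector: `qubit true = |1⟩`, `qubit false = |0⟩`. -/
noncomputable def qubit (b : Bool) : H 1 := ket (fun _ => b)

/-- Tensor product appending a single qubit as the last factor. -/
noncomputable def tensAppend {n : ℕ} (v : H n) (w : H 1) : H (n + 1) :=
  fun f => v (fun i => f i.castSucc) * w (fun _ => f (Fin.last n))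

/-- The protocol states: `S k true = S_+^(k+1)`, `S k false = S_-^(k+1)`. -/
noncomputable def S : (k : ℕ) → Bool → H (k + 1)
  | 0, true => qubit true + qubit false
  | 0, false => qubit true - qubit false
  | k + 1, true =>
      tensAppend (S k true) (qubit true) + tensAppend (S k false) (qubit false)
  | k + 1, false =>
      tensAppend (S k true) (qubit true) - tensAppend (S k false) (qubit false)

/-- Pauli-X operator on qubit `a`: `σ_x^(a)|f⟩ = |f with bit a flipped⟩`. -/
noncomputable def sigmaX {n : ℕ} (a : Fin n) (v : H n) : H n :=
  fun f => v (Function.update f a (!(f a)))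

/-- Product of Pauli-Z operators over a set `s` of qubits. -/
noncomputable def zProd {n : ℕ} (s : Finset (Fin n)) (v : H n) : H n :=
  fun f => (∏ b ∈ s, (if f b then (-1 : ℂ) else 1)) * v f

/-- The set of nearest neighbours of site `a` on the line `{0, …, n−1}` (0-indexed). -/
def neighbours {n : ℕ} (a : Fin n) : Finset (Fin n) :=
  Finset.univ.filter (fun b : Fin n => (b : ℕ) + 1 = (a : ℕ) ∨ (a : ℕ) + 1 = (b : ℕ))

/-- Linear-cluster stabilizer `K_n^(a) = σ_x^(a) ∏_{b ∈ N(a)} σ_z^(b)`. -/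
noncomputable def Kstab {n : ℕ} (a : Fin n) (v : H n) : H n :=
  sigmaX a (zProd (neighbours a) v)

/-- The phase-dressed protocol states `S̃_±^(k+1)` (phases `χ_(j+1)` of the paper are
`χ j`): `S̃_±^(1) = e^{−iχ_1/2}|1⟩ ± e^{iχ_1/2}|0⟩` and
`S̃_±^(k+1) = e^{−iχ_{k+1}/2} S̃_+^(k) ⊗ |1⟩ ± e^{iχ_{k+1}/2} S̃_-^(k) ⊗ |0⟩`. -/
noncomputable def St (χ : ℕ → ℝ) : (k : ℕ) → Bool → H (k + 1)
  | 0, true =>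
      Complex.exp (-(Complex.I * (χ 0) / 2)) • qubit true +
        Complex.exp (Complex.I * (χ 0) / 2) • qubit false
  | 0, false =>
      Complex.exp (-(Complex.I * (χ 0) / 2)) • qubit true -
        Complex.exp (Complex.I * (χ 0) / 2) • qubit false
  | k + 1, true =>
      Complex.exp (-(Complex.I * (χ (k + 1)) / 2)) • tensAppend (St χ k true) (qubit true) +
        Complex.exp (Complex.I * (χ (k + 1)) / 2) • tensAppend (St χ k false) (qubit false)
  | k + 1, false =>
      Complex.exp (-(Complex.I * (χ (k + 1)) / 2)) • tensAppend (St χ k true) (qubit true) -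
        Complex.exp (Complex.I * (χ (k + 1)) / 2) • tensAppend (St χ k false) (qubit false)

/-- The local diagonal unitary `U = D(χ_1) ⊗ ⋯ ⊗ D(χ_n)` on `H_n`, where
`D(χ)|1⟩ = e^{−iχ/2}|1⟩` and `D(χ)|0⟩ = e^{iχ/2}|0⟩`; its inverse is `Dloc (−χ)`. -/
noncomputable def Dloc (χ : ℕ → ℝ) {n : ℕ} (v : H n) : H n :=
  fun f =>
    (∏ i : Fin n, Complex.exp ((if f i then (-1 : ℂ) else 1) * Complex.I * (χ (i : ℕ)) / 2)) *
      v f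

/-- The conjugated stabilizer `K̃_n^(a) = U K_n^(a) U⁻¹` with
`U = D(χ_1) ⊗ ⋯ ⊗ D(χ_n)` (so `U⁻¹ = D(−χ_1) ⊗ ⋯ ⊗ D(−χ_n)`). -/
noncomputable def Ktilde (χ : ℕ → ℝ) {n : ℕ} (a : Fin n) (v : H n) : H n :=
  Dloc χ (Kstab a (Dloc (fun i => -(χ i)) v))

lemma qubit_apply (b c : Bool) : qubit b (fun _ => c) = if c = b then 1 else 0 := by
  cases b <;> cases c <;> simp [qubit, ket, funext_iff]

lemma S_zero_apply (b : Bool) (f : Fin 1 → Bool) :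
    S 0 b f = if f 0 then 1 else if b then 1 else -1 := by
  have hf : f = fun _ => f 0 := by
    funext i; exact congrArg f (Fin.fin_one_eq_zero i)
  generalize f 0 = c at hf
  subst hf
  cases b <;> cases c <;> simp [S, qubit_apply]

lemma S_succ_apply (k : ℕ) (b : Bool) (f : Fin (k + 2) → Bool) :
    S (k + 1) b f = (if f (Fin.last (k + 1)) then 1 else if b then 1 else -1) *
      S k (f (Fin.last (k + 1))) (fun i => f i.castSucc) := by
  cases h : f (Fin.last (k + 1)) <;> cases b <;>
    simp [S, tensAppend, qubit_apply, h]

lemma St_eq (χ : ℕ → ℝ) (k : ℕ) (b : Bool) : St χ k b = Dloc χ (S k b) := by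
  induction k generalizing b with
  | zero =>
    funext f
    have hf : f = fun _ => f 0 := by
      funext i; exact congrArg f (Fin.fin_one_eq_zero i)
    generalize f 0 = c at hf
    subst hf
    cases b <;> cases c <;> simp [St, Dloc, S_zero_apply, qubit_apply, neg_div]
  | succ k ih =>
    funext f
    rw [Dloc, S_succ_apply, Fin.prod_univ_castSucc]
    cases h : f (Fin.last (k + 1)) <;> cases b <;>
      simp [St, tensAppend, qubit_apply, h, ih, Dloc, neg_div] <;> ring

lemma Dloc_inv (χ : ℕ → ℝ) {n : ℕ} (v : H n) : Dloc (fun i => -(χ i)) (Dloc χ v) = v := by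
  funext f
  simp only [Dloc]
  rw [← mul_assoc, ← Finset.prod_mul_distrib, Finset.prod_eq_one, one_mul]
  intro i _
  rw [← Complex.exp_add, ← Complex.exp_zero]
  congr 1
  push_cast
  ring

lemma Dloc_smul (χ : ℕ → ℝ) {n : ℕ} (c : ℂ) (v : H n) : Dloc χ (c • v) = c • Dloc χ v := by
  funext f
  simp only [Dloc, Pi.smul_apply, smul_eq_mul]
  ring

lemma neigh_prod_last (k : ℕ) (f : Fin (k + 2) → Bool) :
    (∏ b ∈ neighbours (Fin.last (k + 1)), (if f b then (-1 : ℂ) else 1)) =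
      if f (Fin.last k).castSucc then (-1 : ℂ) else 1 := by
  have : neighbours (Fin.last (k + 1)) = {(Fin.last k).castSucc} := by
    ext b
    have := b.isLt
    simp only [neighbours, Finset.mem_filter, Finset.mem_univ, true_and, Finset.mem_singleton,
      Fin.ext_iff, Fin.val_last, Fin.val_castSucc]
    omega
  rw [this, Finset.prod_singleton]

lemma neigh_prod_castSucc (k : ℕ) (a : Fin (k + 1)) (f : Fin (k + 2) → Bool) :
    (∏ b ∈ neighbours a.castSucc, (if f b then (-1 : ℂ) else 1)) =
      (∏ b ∈ neighbours a, (if f b.castSucc then (-1 : ℂ) else 1)) *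
      (if a = Fin.last k then (if f (Fin.last (k + 1)) then (-1 : ℂ) else 1) else 1) := by
  have h := a.isLt
  simp only [neighbours, Finset.prod_filter]
  rw [Fin.prod_univ_castSucc]
  congr 1
  have : (((Fin.last (k + 1) : Fin (k + 2)) : ℕ) + 1 = (a.castSucc : ℕ) ∨
      (a.castSucc : ℕ) + 1 = ((Fin.last (k + 1) : Fin (k + 2)) : ℕ)) ↔ a = Fin.last k := by
    simp only [Fin.ext_iff, Fin.val_last, Fin.val_castSucc]
    omega
  simp only [this]

lemma Kstab_S_apply (k : ℕ) (b : Bool) (a : Fin (k + 1)) (f : Fin (k + 1) → Bool) :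
    Kstab a (S k b) f = ((if a = 0 then (-1 : ℂ) else 1) *
      (if a = Fin.last k then (if b then (-1 : ℂ) else 1) else 1)) * S k b f := by
  induction k generalizing b with
  | zero =>
    have ha : a = 0 := Fin.fin_one_eq_zero a
    subst ha
    have hn : neighbours (0 : Fin 1) = ∅ := by decide
    cases b <;> cases h : f 0 <;> simp [Kstab, sigmaX, zProd, S_zero_apply, h, hn]
  | succ k ih =>
    induction a using Fin.lastCases with
    | last =>
      have hc : ∀ x, (fun i : Fin (k + 1) =>
          Function.update f (Fin.last (k + 1)) x i.castSucc) = fun i => f i.castSucc := by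
        intro x; funext i
        rw [Function.update_of_ne (Fin.castSucc_lt_last i).ne]
      have hl : ∀ (c : Bool) (g : Fin (k + 1) → Bool),
          S k (!c) g = (if g (Fin.last k) then (1 : ℂ) else -1) * S k c g := by
        intro c g
        cases k with
        | zero => cases c <;> cases h : g 0 <;> simp [S_zero_apply, h]
        | succ k => cases c <;> cases h : g (Fin.last (k + 1)) <;>
            simp only [S_succ_apply, h] <;> simp
      simp only [Kstab, sigmaX, zProd, neigh_prod_last, S_succ_apply, hc, hl,
        Function.update_self, Function.update_of_ne (Fin.castSucc_lt_last (Fin.last k)).ne]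
      have h0 : Fin.last (k + 1) ≠ 0 := Fin.last_pos.ne'
      cases b <;> cases f (Fin.last (k + 1)) <;> cases f (Fin.last k).castSucc <;> simp [h0]
    | cast a =>
      have hc : ∀ x, (fun i : Fin (k + 1) =>
          Function.update f a.castSucc x i.castSucc) =
            Function.update (fun i : Fin (k + 1) => f i.castSucc) a x := by
        intro x; funext i
        by_cases h : i = a
        · subst h; simp
        · rw [Function.update_of_ne h, Function.update_of_ne]
          simpa using h
      have hc' : ∀ x (i : Fin (k + 1)), Function.update f a.castSucc x i.castSucc =
            Function.update (fun i : Fin (k + 1) => f i.castSucc) a x i :=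
        fun x i => congrFun (hc x) i
      have IH := ih (f (Fin.last (k + 1))) a (fun i => f i.castSucc)
      simp only [Kstab, sigmaX, zProd] at IH
      have hne : (a.castSucc : Fin (k + 2)) ≠ Fin.last (k + 1) := (Fin.castSucc_lt_last a).ne
      have h0 : (a.castSucc : Fin (k + 2)) = 0 ↔ a = 0 := by
        rw [Fin.ext_iff, Fin.ext_iff]; rfl
      simp only [Kstab, sigmaX, zProd, neigh_prod_castSucc, S_succ_apply, hc',
        Function.update_of_ne hne.symm, if_neg hne, h0]
      have hs : ∀ p q r s : ℂ, p * q * (r * s) = q * r * (p * s) := by intros; ring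
      rw [hs, IH]
      clear IH hc hc' ih h0 hne
      generalize f (Fin.last (k + 1)) = c
      split_ifs <;> simp_all

/-- For every `n ≥ 2` (here `n = k + 1`, `k ≥ 1`) and every site `a`, the phase-dressed
protocol states are eigenvectors of the conjugated stabilizers `K̃_n^(a) = U K_n^(a) U⁻¹`
with the same eigenvalues as in the unphased case: `K̃_n^(a) S̃_+^(n) = (−1)^{k_+^(a)} S̃_+^(n)`
and `K̃_n^(a) S̃_-^(n) = (−1)^{k_-^(a)} S̃_-^(n)`, with `k_+^(a) = 1` iff `a` is the first or
last site and `k_-^(a) = 1` iff `a` is the first site (0-indexed here). -/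
theorem dressed_states_stabilized_by_conjugated_stabilizers :
    ∀ (χ : ℕ → ℝ) (k : ℕ), 1 ≤ k → ∀ a : Fin (k + 1),
      Ktilde χ a (St χ k true) =
        (if a = 0 ∨ a = Fin.last k then (-1 : ℂ) else 1) • St χ k true ∧
      Ktilde χ a (St χ k false) =
        (if a = 0 then (-1 : ℂ) else 1) • St χ k false := by
  intro χ k hk a
  have key : ∀ b : Bool, Ktilde χ a (St χ k b) = ((if a = 0 then (-1 : ℂ) else 1) *
      (if a = Fin.last k then (if b then (-1 : ℂ) else 1) else 1)) • St χ k b := by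
    intro b
    have hK : Kstab a (S k b) = ((if a = 0 then (-1 : ℂ) else 1) *
        (if a = Fin.last k then (if b then (-1 : ℂ) else 1) else 1)) • S k b := by
      funext f
      rw [Kstab_S_apply, Pi.smul_apply, smul_eq_mul]
    rw [St_eq, Ktilde, Dloc_inv, hK, Dloc_smul]
  have h0 : ¬ (0 : Fin (k + 1)) = Fin.last k := by
    simp only [Fin.ext_iff, Fin.val_last, Fin.val_zero]
    omega
  have hk0 : k ≠ 0 := by omega
  refine ⟨?_, ?_⟩
  · rw [key]
    by_cases h : a = 0
    · subst h; simp [h0]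
    · by_cases h' : a = Fin.last k <;> simp only [h, h', if_true, if_false, or_true, or_false] <;>
        simp [hk0]
  · rw [key]
    simp
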